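/- arXiv:0809.1546 — 3 statements merged into one kernel-verified Lean document; each statement's English description precedes it below -/
import Mathlib

section
/- Let n ≥ 1, let G be a discrete subgroup of PU(1,n), and let (γ_m) be a sequence of pairwise distinct elements of G converging, in the sense of quasi-projective transformations, to a quasi-projective map γ. Then the image Im(γ) is a single point, and this point lies in ∂𝐇ⁿ_ℂ. -/
open Filter Topology Matrix

noncomputable section

abbrev Vec (n : ℕ) := Fin (n + 1) → ℂ
abbrev Mat (n : ℕ) := Matrix (Fin (n + 1)) (Fin (n + 1)) ℂ
abbrev Pn (n : ℕ) := Projectivization ℂ (Vec n)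

instance (n : ℕ) : TopologicalSpace (Pn n) :=
  inferInstanceAs (TopologicalSpace (Quotient (projectivizationSetoid ℂ (Vec n))))

def herm (n : ℕ) (u v : Vec n) : ℂ :=
  -(u 0 * (starRingEnd ℂ) (v 0)) + ∑ j : Fin n, u j.succ * (starRingEnd ℂ) (v j.succ)

def Hball (n : ℕ) : Set (Pn n) :=
  {p | ∃ v : Vec n, ∃ hv : v ≠ 0, p = Projectivization.mk ℂ v hv ∧ (herm n v v).re < 0}

def Hbdry (n : ℕ) : Set (Pn n) :=
  {p | ∃ v : Vec n, ∃ hv : v ≠ 0, p = Projectivization.mk ℂ v hv ∧ herm n v v = 0}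

abbrev GLn (n : ℕ) := Matrix.GeneralLinearGroup (Fin (n + 1)) ℂ
abbrev PGLn (n : ℕ) := GLn n ⧸ Subgroup.center (GLn n)

lemma glInj {n : ℕ} (A : GLn n) : Function.Injective (Matrix.mulVecLin (A : Mat n)) := by
  intro x y h
  simp only [Matrix.mulVecLin_apply] at h
  have h2 : ((A⁻¹ : GLn n) : Mat n) *ᵥ ((A : Mat n) *ᵥ x)
      = ((A⁻¹ : GLn n) : Mat n) *ᵥ ((A : Mat n) *ᵥ y) := by rw [h]
  rwa [Matrix.mulVec_mulVec, Matrix.mulVec_mulVec, Units.inv_mul, Matrix.one_mulVec,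
    Matrix.one_mulVec] at h2

def actGL {n : ℕ} (A : GLn n) : Pn n → Pn n :=
  Projectivization.map (Matrix.mulVecLin (A : Mat n)) (glInj A)

def act {n : ℕ} (g : PGLn n) : Pn n → Pn n := actGL (Quotient.out g)

-- part 2 --

/-- The subset `U(1,n)` of `GL(n+1,ℂ)`: matrices preserving the Hermitian form. -/
def unitaryGL (n : ℕ) : Set (GLn n) :=
  {A | ∀ u v : Vec n, herm n ((A : Mat n) *ᵥ u) ((A : Mat n) *ᵥ v) = herm n u v}

/-- `PU(1,n)`, the image of `U(1,n)` in `PGL(n+1,ℂ)`. -/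
def PUset (n : ℕ) : Set (PGLn n) := (QuotientGroup.mk : GLn n → PGLn n) '' unitaryGL n

/-- The center of the ball `𝐇ⁿ_ℂ`, namely the image of `(1,0,…,0)`. -/
def basePt (n : ℕ) : Pn n :=
  Projectivization.mk ℂ (Pi.single 0 1) (by
    intro h
    have := congrFun h 0
    simp [Pi.single_eq_same] at this)

lemma basePt_mem_Hball (n : ℕ) : basePt n ∈ Hball n := by
  refine ⟨Pi.single 0 1, _, rfl, ?_⟩
  have : herm n (Pi.single 0 1) (Pi.single 0 1) = -1 := by
    simp [herm, Pi.single_eq_same, Pi.single_eq_of_ne (Fin.succ_ne_zero _)]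
  rw [this]
  norm_num

/-- The set of accumulation points of the orbit `G • x` in `ℙⁿ_ℂ`: limits of
`g_m • x` along sequences of pairwise distinct elements of `G`. -/
def accPts {n : ℕ} (G : Subgroup (PGLn n)) (x : Pn n) : Set (Pn n) :=
  {z | ∃ g : ℕ → G, Function.Injective g ∧
    Tendsto (fun m => act (g m : PGLn n) x) atTop (𝓝 z)}

/-- The Chen–Greenberg limit set of `G`. -/
def LambdaCG {n : ℕ} (G : Subgroup (PGLn n)) : Set (Pn n) := accPts G (basePt n)

/-- Uniform convergence on `K` of a sequence of self-maps of `ℙⁿ_ℂ` to `F`, expressed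
via open neighborhoods of the diagonal.  Since `ℙⁿ_ℂ` is compact Hausdorff, this is
equivalent to uniform convergence on `K` with respect to any metric inducing its
topology. -/
def UnifConvOn {n : ℕ} (f : ℕ → Pn n → Pn n) (F : Pn n → Pn n) (K : Set (Pn n)) : Prop :=
  ∀ W : Set (Pn n × Pn n), IsOpen W → (∀ y, (y, y) ∈ W) →
    ∀ᶠ m in atTop, ∀ x ∈ K, (F x, f m x) ∈ W

/-- Uniform convergence on all compact subsets of `S`. -/
def UnifConvOnCompacts {n : ℕ} (f : ℕ → Pn n → Pn n) (F : Pn n → Pn n)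
    (S : Set (Pn n)) : Prop :=
  ∀ K ⊆ S, IsCompact K → UnifConvOn f F K

/-- The equicontinuity region of a subgroup `G ≤ PGL(n+1,ℂ)`: points having an open
neighborhood `U` on which every sequence in `G` has a subsequence converging uniformly
on compact subsets of `U`. -/
def eqRegion {n : ℕ} (G : Subgroup (PGLn n)) : Set (Pn n) :=
  {z | ∃ U : Set (Pn n), IsOpen U ∧ z ∈ U ∧
    ∀ g : ℕ → G, ∃ φ : ℕ → ℕ, StrictMono φ ∧ ∃ F : Pn n → Pn n,
      UnifConvOnCompacts (fun m => act (g (φ m) : PGLn n)) F U}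

/-- The equicontinuity region of the family of maps `{f m : m ∈ ℕ}`. -/
def eqRegionFam {n : ℕ} (f : ℕ → Pn n → Pn n) : Set (Pn n) :=
  {z | ∃ U : Set (Pn n), IsOpen U ∧ z ∈ U ∧
    ∀ s : ℕ → ℕ, ∃ φ : ℕ → ℕ, StrictMono φ ∧ ∃ F : Pn n → Pn n,
      UnifConvOnCompacts (fun k => f (s (φ k))) F U}

/-- The projectivization of a linear subspace `W ⊆ ℂ^{n+1}`, as a subset of `ℙⁿ_ℂ`. -/
def projSet {n : ℕ} (W : Submodule ℂ (Vec n)) : Set (Pn n) := {p | p.rep ∈ W}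

/-- A complex projective hyperplane: the projectivization of an `n`-dimensional
subspace of `ℂ^{n+1}`. -/
def IsProjHyperplane {n : ℕ} (S : Set (Pn n)) : Prop :=
  ∃ W : Submodule ℂ (Vec n), Module.finrank ℂ W = n ∧ S = projSet W

/-- A complex projective line: the projectivization of a `2`-dimensional subspace. -/
def IsProjLine {n : ℕ} (S : Set (Pn n)) : Prop :=
  ∃ W : Submodule ℂ (Vec n), Module.finrank ℂ W = 2 ∧ S = projSet W

/-- The kernel in `ℙⁿ_ℂ` of the quasi-projective map induced by the nonzero matrix `M`. -/
def qKer {n : ℕ} (M : Mat n) : Set (Pn n) := projSet (LinearMap.ker (Matrix.mulVecLin M))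

/-- The image in `ℙⁿ_ℂ` of the quasi-projective map induced by the nonzero matrix `M`. -/
def qIm {n : ℕ} (M : Mat n) : Set (Pn n) := projSet (LinearMap.range (Matrix.mulVecLin M))

/-- The quasi-projective map `ℙⁿ_ℂ ∖ Ker(M) → ℙⁿ_ℂ` induced by the nonzero matrix `M`
(extended to all of `ℙⁿ_ℂ` by the identity on `Ker(M)`, where it is irrelevant). -/
def qMap {n : ℕ} (M : Mat n) : Pn n → Pn n := fun p =>
  if h : M *ᵥ p.rep ≠ 0 then Projectivization.mk ℂ (M *ᵥ p.rep) h else p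

/-- Convergence of a sequence of transformations of `ℙⁿ_ℂ` to the quasi-projective map
induced by `M`, in the sense of quasi-projective transformations: uniform convergence
on compact subsets of `ℙⁿ_ℂ ∖ Ker(M)`. -/
def QPConv {n : ℕ} (f : ℕ → Pn n → Pn n) (M : Mat n) : Prop :=
  UnifConvOnCompacts f (qMap M) (qKer M)ᶜ

/-- The special linear group `SL(n+1,ℂ)`. -/
abbrev SLn (n : ℕ) := Matrix.SpecialLinearGroup (Fin (n + 1)) ℂ

/-- The projective special linear group `PSL(n+1,ℂ) = SL(n+1,ℂ)/center`. -/
abbrev PSLn (n : ℕ) := SLn n ⧸ Subgroup.center (SLn n)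

/-- The projective transformation induced by an element of `SL(n+1,ℂ)`. -/
def actSL {n : ℕ} (A : SLn n) : Pn n → Pn n := actGL (Matrix.SpecialLinearGroup.toGL A)

/-- The projective transformation induced by an element of `PSL(n+1,ℂ)` (via an
arbitrary representative; all representatives induce the same transformation). -/
def actPSL {n : ℕ} (g : PSLn n) : Pn n → Pn n := actSL (Quotient.out g)

/-- The projective hyperplane tangent to `∂𝐇ⁿ_ℂ` at `p`: the projectivization of the
Hermitian orthogonal complement of a lift of `p`. -/
def tangentAt {n : ℕ} (p : Pn n) : Set (Pn n) := {q | herm n q.rep p.rep = 0}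

end

lemma continuous_herm (n : ℕ) : Continuous fun p : Vec n × Vec n => herm n p.1 p.2 := by
  unfold herm
  fun_prop

lemma herm_smul_smul {n : ℕ} (c d : ℂ) (u v : Vec n) :
    herm n (c • u) (d • v) = c * (starRingEnd ℂ) d * herm n u v := by
  simp only [herm, Pi.smul_apply, smul_eq_mul, map_mul, mul_add, Finset.mul_sum]
  congr 1
  · ring
  · exact Finset.sum_congr rfl fun j _ => by ring

lemma herm_sub_smul_left {n : ℕ} (c : ℂ) (u w v : Vec n) :
    herm n (u - c • w) v = herm n u v - c * herm n w v := by
  simp only [herm, Pi.sub_apply, Pi.smul_apply, smul_eq_mul, mul_add, sub_mul,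
    Finset.mul_sum, Finset.sum_sub_distrib]
  have : ∑ x : Fin n, c * w x.succ * (starRingEnd ℂ) (v x.succ)
      = ∑ x : Fin n, c * (w x.succ * (starRingEnd ℂ) (v x.succ)) :=
    Finset.sum_congr rfl fun j _ => by ring
  rw [this]
  ring

lemma herm_sub_smul_right {n : ℕ} (c : ℂ) (u w v : Vec n) :
    herm n v (u - c • w) = herm n v u - (starRingEnd ℂ) c * herm n v w := by
  simp only [herm, Pi.sub_apply, Pi.smul_apply, smul_eq_mul, mul_add, mul_sub, map_sub, map_mul,
    Finset.mul_sum, Finset.sum_sub_distrib]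
  have : ∑ x : Fin n, v x.succ * ((starRingEnd ℂ) c * (starRingEnd ℂ) (w x.succ))
      = ∑ x : Fin n, (starRingEnd ℂ) c * (v x.succ * (starRingEnd ℂ) (w x.succ)) :=
    Finset.sum_congr rfl fun j _ => by ring
  rw [this]
  ring

/-- The Hermitian form is definite on the hyperplane `u₀ = 0`. -/
lemma eq_zero_of_herm_self_eq_zero {n : ℕ} {u : Vec n} (h0 : u 0 = 0) (h : herm n u u = 0) :
    u = 0 := by
  simp only [herm, h0, zero_mul, neg_zero, zero_add, Complex.mul_conj] at h
  have h' : ∑ j : Fin n, Complex.normSq (u j.succ) = 0 := by exact_mod_cast h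
  rw [Finset.sum_eq_zero_iff_of_nonneg fun j _ => Complex.normSq_nonneg _] at h'
  funext i
  refine Fin.cases h0 (fun j => ?_) i
  simpa using h' j (Finset.mem_univ j)

lemma eq_zero_of_forall_herm_eq_zero {n : ℕ} {u : Vec n} (h : ∀ v, herm n u v = 0) : u = 0 := by
  have h0 : u 0 = 0 := by
    simpa [herm] using h (Pi.single 0 1)
  exact eq_zero_of_herm_self_eq_zero h0 (h u)

/-- Totally isotropic subspaces are at most one-dimensional. -/
lemma mem_span_singleton_of_isotropic {n : ℕ} {w u : Vec n} (hw : w ≠ 0)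
    (hww : herm n w w = 0) (huu : herm n u u = 0) (huw : herm n u w = 0)
    (hwu : herm n w u = 0) : u ∈ Submodule.span ℂ {w} := by
  have hw0 : w 0 ≠ 0 := fun h => hw (eq_zero_of_herm_self_eq_zero h hww)
  refine Submodule.mem_span_singleton.2 ⟨u 0 / w 0, ?_⟩
  refine (sub_eq_zero.1 (eq_zero_of_herm_self_eq_zero (u := u - (u 0 / w 0) • w) ?_ ?_)).symm
  · simp [hw0]
  · simp [herm_sub_smul_left, herm_sub_smul_right, hww, huu, huw, hwu]

/-- The orthogonal projection, for the standard Hermitian inner product, onto the line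
spanned by `v`. -/
noncomputable def lineProjection {n : ℕ} (v : Vec n) : Mat n :=
  (v ⬝ᵥ star v)⁻¹ • vecMulVec v (star v)

lemma lineProjection_smul {n : ℕ} {c : ℂ} (hc : c ≠ 0) (v : Vec n) :
    lineProjection (c • v) = lineProjection v := by
  have hc' : star c ≠ 0 := star_ne_zero.2 hc
  ext i j
  simp only [lineProjection, star_smul, smul_dotProduct, dotProduct_smul, Matrix.smul_apply,
    vecMulVec_apply, Pi.smul_apply, smul_eq_mul, Pi.star_apply]
  rw [mul_inv, mul_inv]
  field_simp

lemma lineProjection_mulVec {n : ℕ} (v x : Vec n) :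
    lineProjection v *ᵥ x = ((v ⬝ᵥ star v)⁻¹ * (star v ⬝ᵥ x)) • v := by
  rw [lineProjection, Matrix.smul_mulVec, vecMulVec_mulVec, mul_smul]
  simp

open scoped ComplexOrder in
lemma mem_span_of_lineProjection_eq {n : ℕ} {v w : Vec n} (hv : v ≠ 0)
    (h : lineProjection v = lineProjection w) : v ∈ Submodule.span ℂ {w} := by
  have h1 : lineProjection v *ᵥ v = v := by
    rw [lineProjection_mulVec, dotProduct_comm (star v), inv_mul_cancel₀, one_smul]
    exact fun h => hv (dotProduct_self_star_eq_zero.1 h)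
  rw [h, lineProjection_mulVec] at h1
  exact Submodule.mem_span_singleton.2 ⟨_, h1⟩

open scoped ComplexOrder in
lemma continuousAt_lineProjection {n : ℕ} {v : Vec n} (hv : v ≠ 0) :
    ContinuousAt (lineProjection (n := n)) v := by
  have h1 : Continuous fun v : Vec n => v ⬝ᵥ star v := by fun_prop
  have h2 : Continuous fun v : Vec n => vecMulVec v (star v) := by fun_prop
  exact (h1.continuousAt.inv₀ fun h => hv (dotProduct_self_star_eq_zero.1 h)).smul
    h2.continuousAt

lemma lineProjection_rep {n : ℕ} {v : Vec n} (hv : v ≠ 0) :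
    lineProjection (Projectivization.mk ℂ v hv).rep = lineProjection v := by
  obtain ⟨a, ha⟩ := Projectivization.exists_smul_eq_mk_rep ℂ v hv
  rw [← ha, Units.smul_def, lineProjection_smul a.ne_zero]

lemma continuous_lineProjection_rep (n : ℕ) :
    Continuous fun p : Pn n => lineProjection p.rep := by
  refine continuous_coinduced_dom.2 (continuous_iff_continuousAt.2 fun v => ?_)
  refine ((continuousAt_lineProjection v.2).comp
    continuous_subtype_val.continuousAt).congr (Eventually.of_forall fun w => ?_)
  exact (lineProjection_rep w.2).symm

lemma UnifConvOnCompacts.tendsto_lineProjection {n : ℕ} {f : ℕ → Pn n → Pn n}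
    {F : Pn n → Pn n} {S : Set (Pn n)} (h : UnifConvOnCompacts f F S) {p : Pn n} (hp : p ∈ S) :
    Tendsto (fun m => lineProjection (f m p).rep) atTop (𝓝 (lineProjection (F p).rep)) := by
  intro s hs
  obtain ⟨t, hts, ht, hFt⟩ := mem_nhds_iff.1 hs
  have hc := continuous_lineProjection_rep n
  have hclosed : IsClosed {p' : Pn n | lineProjection p'.rep = lineProjection (F p).rep} :=
    isClosed_eq hc continuous_const
  have hW : IsOpen ({q : Pn n × Pn n | lineProjection q.1.rep ≠ lineProjection (F p).rep} ∪
      {q : Pn n × Pn n | lineProjection q.2.rep ∈ t}) :=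
    (hclosed.isOpen_compl.preimage continuous_fst).union
      ((ht.preimage hc).preimage continuous_snd)
  have := h {p} (by simpa using hp) isCompact_singleton _ hW (fun y => by
    by_cases hy : lineProjection y.rep = lineProjection (F p).rep
    · exact Or.inr (by simpa [hy] using hFt)
    · exact Or.inl hy)
  refine this.mono fun m hm => ?_
  rcases hm p rfl with h1 | h1
  · exact absurd rfl h1
  · exact hts h1

lemma lineProjection_act_rep {n : ℕ} (A : GLn n) (p : Pn n) :
    lineProjection (act (A : PGLn n) p).rep = lineProjection ((A : Mat n) *ᵥ p.rep) := by
  obtain ⟨z, hz⟩ := QuotientGroup.mk_out_eq_mul (Subgroup.center (GLn n)) A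
  obtain ⟨c, hc⟩ := Matrix.GeneralLinearGroup.mem_center_iff_val_mem_range_scalar.1 z.2
  have hv : (((A : PGLn n).out : GLn n) : Mat n) *ᵥ p.rep = c • ((A : Mat n) *ᵥ p.rep) := by
    rw [hz, Units.val_mul, ← hc, ← Matrix.mulVec_mulVec, ← Matrix.mulVec_smul]
    congr 1
    simp [Matrix.scalar_apply, ← Matrix.smul_one_eq_diagonal, Matrix.smul_mulVec]
  have h0 : (((A : PGLn n).out : GLn n) : Mat n) *ᵥ p.rep ≠ 0 := fun h =>
    p.rep_nonzero (glInj (A : PGLn n).out (by simpa using h))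
  have hc0 : c ≠ 0 := by
    rintro rfl
    exact h0 (by simpa using hv)
  have hact : act (A : PGLn n) p = Projectivization.mk ℂ _ h0 := by
    conv_lhs => rw [act, actGL, ← p.mk_rep, Projectivization.map_mk]
    rfl
  rw [hact, lineProjection_rep, hv, lineProjection_smul hc0]

lemma lineProjection_qMap_rep {n : ℕ} {M : Mat n} {p : Pn n} (h : M *ᵥ p.rep ≠ 0) :
    lineProjection (qMap M p).rep = lineProjection (M *ᵥ p.rep) := by
  rw [qMap, dif_pos h, lineProjection_rep]

lemma mulVec_mem_of_forall_rep {n : ℕ} {B M : Mat n} {S : Submodule ℂ (Vec n)}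
    (hB : B ≠ 0) (h : ∀ p : Pn n, B *ᵥ p.rep ≠ 0 → M *ᵥ p.rep ∈ S) (x : Vec n) :
    M *ᵥ x ∈ S := by
  have key : ∀ y, B *ᵥ y ≠ 0 → M *ᵥ y ∈ S := by
    intro y hy
    have hy0 : y ≠ 0 := by
      rintro rfl
      simp at hy
    obtain ⟨a, ha⟩ := Projectivization.exists_smul_eq_mk_rep ℂ y hy0
    have := h (Projectivization.mk ℂ y hy0)
    rw [← ha, Units.smul_def, Matrix.mulVec_smul, Matrix.mulVec_smul,
      S.smul_mem_iff a.ne_zero] at this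
    exact this (smul_ne_zero a.ne_zero hy)
  by_cases hx : B *ᵥ x = 0
  · obtain ⟨y, hy⟩ : ∃ y, B *ᵥ y ≠ 0 := by
      by_contra! hall
      exact hB (Matrix.mulVec_injective (funext fun y => by simp [hall y]))
    have h1 := key (x + y) (by rwa [Matrix.mulVec_add, hx, zero_add])
    have := S.sub_mem h1 (key y hy)
    rwa [Matrix.mulVec_add, add_sub_cancel_right] at this
  · exact key x hx

lemma isUnit_of_herm_preserving {n : ℕ} {A : Mat n}
    (hA : ∀ u v, herm n (A *ᵥ u) (A *ᵥ v) = herm n u v) : IsUnit A := by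
  rw [← Matrix.mulVec_injective_iff_isUnit]
  refine (injective_iff_map_eq_zero A.mulVecLin).2 fun u hu => ?_
  refine eq_zero_of_forall_herm_eq_zero fun v => ?_
  rw [← hA, ← Matrix.mulVecLin_apply, hu]
  simp [herm]

lemma isEmbedding_val_GLn (n : ℕ) : IsEmbedding (Units.val : GLn n → Mat n) := by
  refine Units.isEmbedding_val_mk' (f := Inv.inv) (fun A hA => ?_)
    (fun u => (Matrix.coe_units_inv u).symm)
  refine (continuousAt_matrix_inv A ?_).continuousWithinAt
  obtain ⟨u, hu⟩ := (Matrix.isUnit_iff_isUnit_det A).1 hA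
  rw [← hu]
  exact NormedRing.inverse_continuousAt u

/-- No injective sequence in a discrete subgroup converges in the ambient group. -/
lemma not_tendsto_of_injective_of_discrete {Γ : Type*} [Group Γ] [TopologicalSpace Γ]
    [IsTopologicalGroup Γ] {G : Subgroup Γ} [DiscreteTopology G] {g : ℕ → G}
    (hg : Function.Injective g) (a : Γ) : ¬ Tendsto (fun k => (g k : Γ)) atTop (𝓝 a) := by
  intro h
  have h1 : Tendsto (fun k => ((g (k + 1) * (g k)⁻¹ : G) : Γ)) atTop (𝓝 ((1 : G) : Γ)) := by
    simpa using (h.comp (tendsto_add_atTop_nat 1)).mul h.inv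
  have h2 := tendsto_subtype_rng.2 h1
  rw [nhds_discrete, tendsto_pure] at h2
  obtain ⟨k, hk⟩ := h2.exists
  exact absurd (hg (mul_inv_eq_one.1 hk)) (by simp)

section

open scoped Matrix.Norms.Elementwise

/-- Lifts to `U(1,n)` of pairwise distinct elements of a discrete subgroup escape to infinity. -/
lemma tendsto_norm_atTop_of_discrete {n : ℕ} {G : Subgroup (PGLn n)} [DiscreteTopology G]
    {γ : ℕ → G} (hγ : Function.Injective γ) {A : ℕ → GLn n} (hA : ∀ m, A m ∈ unitaryGL n)
    (hAγ : ∀ m, (A m : PGLn n) = γ m) :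
    Tendsto (fun m => ‖(A m : Mat n)‖) atTop atTop := by
  have : ProperSpace (Mat n) := inferInstanceAs (ProperSpace (Fin (n + 1) → Fin (n + 1) → ℂ))
  rw [tendsto_atTop]
  by_contra! hcon
  obtain ⟨C, hC⟩ := hcon
  obtain ⟨L, -, φ, hφ, hL⟩ := tendsto_subseq_of_frequently_bounded
    (s := Metric.closedBall (0 : Mat n) C) Metric.isBounded_closedBall
    (x := fun m => (A m : Mat n)) (by
      refine (not_eventually.1 hC).mono fun m hm => ?_
      simpa using (not_not.1 hm).le)
  have hLherm : ∀ u v, herm n (L *ᵥ u) (L *ᵥ v) = herm n u v := by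
    intro u v
    have hc : Continuous fun B : Mat n => herm n (B *ᵥ u) (B *ᵥ v) :=
      (continuous_herm n).comp
        ((continuous_id.matrix_mulVec continuous_const).prodMk
          (continuous_id.matrix_mulVec continuous_const))
    refine tendsto_nhds_unique ((hc.tendsto L).comp hL) ?_
    refine tendsto_const_nhds.congr fun k => ?_
    exact (hA (φ k) u v).symm
  obtain ⟨U, rfl⟩ := isUnit_of_herm_preserving hLherm
  have hU : Tendsto (fun k => A (φ k)) atTop (𝓝 U) :=
    (isEmbedding_val_GLn n).tendsto_nhds_iff.2 hL
  have hmk : Continuous (QuotientGroup.mk : GLn n → PGLn n) := continuous_quot_mk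
  refine not_tendsto_of_injective_of_discrete (g := γ ∘ φ) (hγ.comp hφ.injective) (U : PGLn n) ?_
  refine ((hmk.tendsto U).comp hU).congr fun k => ?_
  exact hAγ (φ k)

/-- A sequence in `U(1,n)` escaping to infinity converges projectively, along a subsequence, to
a nonzero matrix whose range is totally isotropic. -/
lemma exists_isotropic_limit {n : ℕ} {A : ℕ → GLn n} (hA : ∀ m, A m ∈ unitaryGL n)
    (h : Tendsto (fun m => ‖(A m : Mat n)‖) atTop atTop) :
    ∃ B : Mat n, B ≠ 0 ∧ (∀ u v, herm n (B *ᵥ u) (B *ᵥ v) = 0) ∧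
      ∃ φ : ℕ → ℕ, StrictMono φ ∧ ∃ c : ℕ → ℂ, (∀ k, c k ≠ 0) ∧
        Tendsto (fun k => c k • (A (φ k) : Mat n)) atTop (𝓝 B) := by
  have : ProperSpace (Mat n) := inferInstanceAs (ProperSpace (Fin (n + 1) → Fin (n + 1) → ℂ))
  have hne : ∀ m, ‖(A m : Mat n)‖ ≠ 0 := fun m => norm_ne_zero_iff.2 (A m).ne_zero
  obtain ⟨B, hB, φ, hφ, hlim⟩ := (isCompact_sphere (0 : Mat n) 1).tendsto_subseq
    (x := fun m => ((‖(A m : Mat n)‖ : ℂ))⁻¹ • (A m : Mat n)) (fun m => by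
      rw [mem_sphere_zero_iff_norm, norm_smul, norm_inv, Complex.norm_real, norm_norm,
        inv_mul_cancel₀ (hne m)])
  refine ⟨B, ?_, fun u v => ?_, φ, hφ, fun k => ((‖(A (φ k) : Mat n)‖ : ℂ))⁻¹, fun k => ?_, hlim⟩
  · rintro rfl
    simp at hB
  · have hc : Continuous fun B : Mat n => herm n (B *ᵥ u) (B *ᵥ v) :=
      (continuous_herm n).comp
        ((continuous_id.matrix_mulVec continuous_const).prodMk
          (continuous_id.matrix_mulVec continuous_const))
    refine tendsto_nhds_unique ((hc.tendsto B).comp hlim) ?_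
    have hinv : Tendsto (fun k => ((‖(A (φ k) : Mat n)‖ : ℂ))⁻¹) atTop (𝓝 0) := by
      have := (Complex.continuous_ofReal.tendsto 0).comp
        (tendsto_inv_atTop_zero.comp (h.comp hφ.tendsto_atTop))
      simpa [Function.comp_def] using this
    have h2 : Tendsto (fun k => ((‖(A (φ k) : Mat n)‖ : ℂ))⁻¹ *
        (starRingEnd ℂ) ((‖(A (φ k) : Mat n)‖ : ℂ))⁻¹ * herm n u v) atTop (𝓝 0) := by
      have := (hinv.mul ((Complex.continuous_conj.tendsto 0).comp hinv)).mul_const (herm n u v)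
      simpa only [map_zero, mul_zero, zero_mul, Function.comp_apply] using this
    refine h2.congr fun k => ?_
    simp only [Function.comp_apply, Matrix.smul_mulVec]
    rw [herm_smul_smul, hA (φ k) u v]
  · exact inv_ne_zero (by exact_mod_cast hne (φ k))

end

lemma mulVec_mem_span_of_QPConv {n : ℕ} {A : ℕ → GLn n} {M B : Mat n}
    (hconv : QPConv (fun m => act (A m : PGLn n)) M) {φ : ℕ → ℕ} (hφ : StrictMono φ)
    {c : ℕ → ℂ} (hc : ∀ k, c k ≠ 0)
    (hB : Tendsto (fun k => c k • (A (φ k) : Mat n)) atTop (𝓝 B)) {p : Pn n}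
    (hBp : B *ᵥ p.rep ≠ 0) : M *ᵥ p.rep ∈ Submodule.span ℂ {B *ᵥ p.rep} := by
  by_cases hMp : M *ᵥ p.rep = 0
  · rw [hMp]
    exact Submodule.zero_mem _
  refine mem_span_of_lineProjection_eq hMp ?_
  have h1 := (UnifConvOnCompacts.tendsto_lineProjection hconv (p := p)
    (by simpa [qKer, projSet] using hMp)).comp hφ.tendsto_atTop
  rw [lineProjection_qMap_rep hMp] at h1
  have hcont : Continuous fun D : Mat n => D *ᵥ p.rep :=
    continuous_id.matrix_mulVec continuous_const
  refine tendsto_nhds_unique h1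
    (((continuousAt_lineProjection hBp).tendsto.comp ((hcont.tendsto B).comp hB)).congr ?_)
  intro k
  simp only [Function.comp_apply, lineProjection_act_rep, Matrix.smul_mulVec,
    lineProjection_smul (hc k)]

lemma projSet_span_singleton {n : ℕ} {w : Vec n} (hw : w ≠ 0) :
    projSet (Submodule.span ℂ {w}) = {Projectivization.mk ℂ w hw} := by
  ext p
  rw [projSet, Set.mem_ofPred_eq, Submodule.mem_span_singleton, Set.mem_singleton_iff]
  conv_rhs => rw [← p.mk_rep]
  rw [Projectivization.mk_eq_mk_iff']

/-- If a sequence of pairwise distinct elements of a discrete subgroup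
`G` of `PU(1,n)` converges as quasi-projective transformations to `γ`, then `Im(γ)` is a
single point lying on `∂𝐇ⁿ_ℂ`. -/
theorem qp_limit_image_is_boundary_point
    (n : ℕ) (hn : 1 ≤ n) (G : Subgroup (PGLn n))
    (hPU : (G : Set (PGLn n)) ⊆ PUset n) (hdisc : DiscreteTopology ↥G)
    (γ : ℕ → G) (hγ : Function.Injective γ) (M : Mat n) (hM : M ≠ 0)
    (hconv : QPConv (fun m => act (γ m : PGLn n)) M) :
    ∃ q ∈ Hbdry n, qIm M = {q} := by
  choose A hA hAγ using fun m => hPU (γ m).2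
  obtain ⟨B, hB, hiso, φ, hφ, c, hc, hlim⟩ :=
    exists_isotropic_limit hA (tendsto_norm_atTop_of_discrete hγ hA hAγ)
  simp_rw [← hAγ] at hconv
  obtain ⟨x, hx⟩ : ∃ x, M *ᵥ x ≠ 0 := by
    by_contra! hall
    exact hM (Matrix.mulVec_injective (funext fun y => by simp [hall y]))
  obtain ⟨y, hy⟩ : ∃ y, B *ᵥ y ≠ 0 := by
    by_contra! hall
    exact hB (Matrix.mulVec_injective (funext fun z => by simp [hall z]))
  have hmem : ∀ z, M *ᵥ z ∈ Submodule.span ℂ {B *ᵥ y} := by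
    refine mulVec_mem_of_forall_rep hB fun p hp => ?_
    refine Submodule.span_le.2 (Set.singleton_subset_iff.2 ?_)
      (mulVec_mem_span_of_QPConv hconv hφ hc hlim hp)
    exact mem_span_singleton_of_isotropic hy (hiso _ _) (hiso _ _) (hiso _ _) (hiso _ _)
  have hrange : LinearMap.range (Matrix.mulVecLin M) = Submodule.span ℂ {B *ᵥ y} := by
    refine le_antisymm ?_ (Submodule.span_le.2 (Set.singleton_subset_iff.2 ?_))
    · rintro _ ⟨z, rfl⟩
      exact hmem z
    · obtain ⟨a, ha⟩ := Submodule.mem_span_singleton.1 (hmem x)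
      have ha0 : a ≠ 0 := by
        rintro rfl
        exact hx (by simpa using ha.symm)
      exact ⟨a⁻¹ • x, by rw [Matrix.mulVecLin_apply, Matrix.mulVec_smul, ← ha,
        inv_smul_smul₀ ha0]⟩
  exact ⟨Projectivization.mk ℂ _ hy, ⟨_, hy, rfl, hiso _ _⟩, by
    rw [qIm, hrange, projSet_span_singleton]⟩
end

section
/- Let n ≥ 1, let G be a discrete subgroup of PU(1,n), and let (γ_m) be a sequence of pairwise distinct elements of G converging, in the sense of quasi-projective transformations, to a quasi-projective map γ. Then Ker(γ) is a complex projective hyperplane tangent to ∂𝐇ⁿ_ℂ: its intersection with the closure of 𝐇ⁿ_ℂ in ℙⁿ_ℂ consists of exactly one point, which lies in ∂𝐇ⁿ_ℂ. -/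
open Filter Topology Matrix

/-- The Gram matrix of the Hermitian form of signature `(1, n)`. -/
def gramMat (n : ℕ) : Mat n := Matrix.diagonal (Fin.cons (-1) fun _ => 1)

lemma herm_eq_dotProduct {n : ℕ} (u v : Vec n) : herm n u v = star v ⬝ᵥ (gramMat n *ᵥ u) := by
  simp [herm, gramMat, dotProduct, Matrix.mulVec_diagonal, Fin.sum_univ_succ, mul_comm]

lemma herm_mulVec {n : ℕ} (A : Mat n) (u v : Vec n) :
    herm n (A *ᵥ u) (A *ᵥ v) = star v ⬝ᵥ ((Aᴴ * gramMat n * A) *ᵥ u) := by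
  rw [herm_eq_dotProduct, Matrix.star_mulVec, ← Matrix.dotProduct_mulVec]
  simp only [Matrix.mulVec_mulVec, Matrix.mul_assoc]

lemma gramMat_mul_self (n : ℕ) : gramMat n * gramMat n = 1 := by
  rw [gramMat, Matrix.diagonal_mul_diagonal, ← Matrix.diagonal_one]
  congr 1
  funext i
  refine Fin.cases ?_ (fun j => ?_) i <;> simp

lemma conjTranspose_mul_gramMat_mul {n : ℕ} {A : GLn n} (hA : A ∈ unitaryGL n) :
    (A : Mat n)ᴴ * gramMat n * (A : Mat n) = gramMat n := by
  ext i j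
  have h := hA (Pi.single j 1) (Pi.single i 1)
  rw [herm_mulVec, herm_eq_dotProduct] at h
  simpa [← Pi.single_star] using h

lemma gramMat_mul_conjTranspose_mul_gramMat_mul {n : ℕ} {A : Mat n}
    (hA : Aᴴ * gramMat n * A = gramMat n) : gramMat n * Aᴴ * gramMat n * A = 1 := by
  rw [Matrix.mul_assoc, Matrix.mul_assoc, ← Matrix.mul_assoc Aᴴ, hA, gramMat_mul_self]

lemma mul_gramMat_mul_conjTranspose {n : ℕ} {A : Mat n} (hA : Aᴴ * gramMat n * A = gramMat n) :
    A * gramMat n * Aᴴ = gramMat n := by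
  have h := mul_eq_one_comm.mp (gramMat_mul_conjTranspose_mul_gramMat_mul hA)
  calc A * gramMat n * Aᴴ = A * (gramMat n * Aᴴ * gramMat n) * gramMat n := by
        simp only [Matrix.mul_assoc, gramMat_mul_self, Matrix.mul_one]
    _ = gramMat n := by rw [h, Matrix.one_mul]

lemma herm_self {n : ℕ} (v : Vec n) :
    herm n v v = ((-‖v 0‖ ^ 2 + ∑ j : Fin n, ‖v j.succ‖ ^ 2 : ℝ) : ℂ) := by
  simp [herm, Complex.mul_conj, Complex.normSq_eq_norm_sq]

lemma eq_zero_of_herm_self_nonpos {n : ℕ} {v : Vec n} (h0 : v 0 = 0) (h : (herm n v v).re ≤ 0) :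
    v = 0 := by
  rw [herm_self, Complex.ofReal_re, h0] at h
  have hs : ∑ j : Fin n, ‖v j.succ‖ ^ 2 = 0 :=
    le_antisymm (by simpa using h) (Finset.sum_nonneg fun _ _ => sq_nonneg _)
  rw [Finset.sum_eq_zero_iff_of_nonneg fun _ _ => sq_nonneg _] at hs
  funext i
  refine Fin.cases h0 (fun j => ?_) i
  simpa using hs j (Finset.mem_univ j)

lemma zeroth_ne_zero_of_isotropic {n : ℕ} {v : Vec n} (hv : v ≠ 0) (h : herm n v v = 0) :
    v 0 ≠ 0 :=
  fun h0 => hv (eq_zero_of_herm_self_nonpos h0 (by simp [h]))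

lemma herm_sub_smul {n : ℕ} (u v : Vec n) (c : ℂ) :
    herm n (u - c • v) (u - c • v) = herm n u u - (starRingEnd ℂ) c * herm n u v
      - c * herm n v u + c * (starRingEnd ℂ) c * herm n v v := by
  simp only [herm_eq_dotProduct, star_sub, star_smul, Matrix.mulVec_sub, Matrix.mulVec_smul,
    sub_dotProduct, dotProduct_sub, smul_dotProduct, dotProduct_smul, smul_eq_mul,
    starRingEnd_apply]
  ring

lemma herm_conj {n : ℕ} (u v : Vec n) : (starRingEnd ℂ) (herm n u v) = herm n v u := by
  simp [herm, mul_comm]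

/-- A nonpositive vector orthogonal to an isotropic vector is proportional to it. -/
lemma eq_smul_of_herm_eq_zero {n : ℕ} {u v : Vec n} (hv : v ≠ 0) (hvv : herm n v v = 0)
    (huv : herm n u v = 0) (huu : (herm n u u).re ≤ 0) : u = (u 0 / v 0) • v := by
  have h0 := zeroth_ne_zero_of_isotropic hv hvv
  refine sub_eq_zero.mp (eq_zero_of_herm_self_nonpos (by simp [h0]) ?_)
  rw [herm_sub_smul, huv, hvv, ← herm_conj u v, huv]
  simpa using huu

/-- A nonzero matrix which is a degenerate limit of unitary matrices has rank one, with isotropic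
image and kernel orthogonal to an isotropic vector. -/
lemma exists_isotropic_rank_one {n : ℕ} {B : Mat n} (hB : B ≠ 0) (h₁ : Bᴴ * gramMat n * B = 0)
    (h₂ : B * gramMat n * Bᴴ = 0) :
    ∃ x y : Vec n, x ≠ 0 ∧ y ≠ 0 ∧ herm n y y = 0 ∧ ∀ u, B *ᵥ u = herm n u y • x := by
  have hiso : ∀ u v, herm n (B *ᵥ u) (B *ᵥ v) = 0 := fun u v => by
    rw [herm_mulVec, h₁]; simp
  obtain ⟨w, hw⟩ : ∃ w, B *ᵥ w ≠ 0 := by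
    by_contra! h
    exact hB (Matrix.ext_of_mulVec_single fun i => by rw [h, Matrix.zero_mulVec])
  set x := B *ᵥ w with hx
  let y : Vec n := gramMat n *ᵥ fun j => (starRingEnd ℂ) (B 0 j / x 0)
  have hy : ∀ u, herm n u y = (B *ᵥ u) 0 / x 0 := fun u => by
    rw [show (B *ᵥ u) 0 = ∑ j, B 0 j * u j from rfl, Fin.sum_univ_succ]
    simp [herm, y, gramMat, Matrix.mulVec_diagonal, add_div, Finset.sum_div, mul_div_left_comm,
      mul_div_assoc]
  have hBu : ∀ u, B *ᵥ u = herm n u y • x := fun u => by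
    rw [hy]
    exact eq_smul_of_herm_eq_zero hw (hiso w w) (hiso u w) (by simp [hiso])
  refine ⟨x, y, hw, ?_, ?_, hBu⟩
  · intro h
    refine hw ?_
    rw [hx, hBu w, h]
    simp [herm]
  · rw [hy]
    have h := congrFun (congrFun h₂ 0) 0
    have h' : (B *ᵥ y) 0 = (B * gramMat n * Bᴴ) 0 0 / (starRingEnd ℂ) (x 0) := by
      rw [Matrix.mulVec_mulVec, Matrix.mul_apply]
      simp [Matrix.mulVec, dotProduct, Finset.sum_div, mul_div_assoc]
    simp [h', h]

lemma tendsto_units {R : Type*} [Monoid R] [TopologicalSpace R] {u : ℕ → Rˣ} {U : Rˣ}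
    (h : Tendsto (fun m => (u m : R)) atTop (𝓝 U))
    (h' : Tendsto (fun m => ((u m)⁻¹ : Rˣ).val) atTop (𝓝 (U⁻¹ : Rˣ).val)) :
    Tendsto u atTop (𝓝 U) :=
  Units.isEmbedding_embedProduct.tendsto_nhds_iff.mpr
    (h.prodMk_nhds ((MulOpposite.continuous_op.tendsto _).comp h'))

/-- A sequence of unitary matrices which converges as matrices converges in the linear group. -/
lemma exists_tendsto_of_tendsto_val {n : ℕ} {A : ℕ → GLn n} (hA : ∀ m, A m ∈ unitaryGL n)
    {L : Mat n} (hlim : Tendsto (fun m => (A m : Mat n)) atTop (𝓝 L)) :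
    ∃ U : GLn n, Tendsto A atTop (𝓝 U) := by
  have hcont : Continuous fun X : Mat n => Xᴴ * gramMat n * X := by fun_prop
  have hL : Lᴴ * gramMat n * L = gramMat n := by
    refine tendsto_nhds_unique ((hcont.tendsto L).comp hlim) ?_
    simp [Function.comp_def, fun m => conjTranspose_mul_gramMat_mul (hA m)]
  have hinv := gramMat_mul_conjTranspose_mul_gramMat_mul hL
  refine ⟨⟨L, gramMat n * Lᴴ * gramMat n, mul_eq_one_comm.mp hinv, hinv⟩, ?_⟩
  have hcont' : Continuous fun X : Mat n => gramMat n * Xᴴ * gramMat n :=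
    (continuous_const.matrix_mul continuous_id.matrix_conjTranspose).matrix_mul continuous_const
  have hlim' : Tendsto (fun m => ((A m)⁻¹ : GLn n).val) atTop
      (𝓝 (gramMat n * Lᴴ * gramMat n)) := by
    refine ((hcont'.tendsto L).comp hlim).congr fun m => ?_
    exact Units.eq_inv_of_mul_eq_one_left (mul_eq_one_comm.mp
      (gramMat_mul_conjTranspose_mul_gramMat_mul (conjTranspose_mul_gramMat_mul (hA m))))
  exact tendsto_units hlim hlim'

section

open scoped Matrix.Norms.Elementwise

/-- Rescaling an unbounded sequence of unitary matrices and passing to a subsequence yields a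
degenerate nonzero limit. -/
lemma exists_rescaled_limit {n : ℕ} {A : ℕ → Mat n}
    (hA : ∀ m, (A m)ᴴ * gramMat n * A m = gramMat n)
    (hnorm : Tendsto (fun m => ‖A m‖) atTop atTop) :
    ∃ (φ : ℕ → ℕ) (c : ℕ → ℂ) (B : Mat n), StrictMono φ ∧ (∀ k, c k ≠ 0) ∧ B ≠ 0 ∧
      Tendsto (fun k => c k • A (φ k)) atTop (𝓝 B) ∧
      Bᴴ * gramMat n * B = 0 ∧ B * gramMat n * Bᴴ = 0 := by
  have : ProperSpace (Mat n) := inferInstanceAs (ProperSpace (Fin (n + 1) → Fin (n + 1) → ℂ))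
  have hJ : gramMat n ≠ 0 := fun h => by simpa [h] using gramMat_mul_self n
  have hne : ∀ m, A m ≠ 0 := fun m h => hJ (by rw [← hA m, h]; simp)
  have hsphere : ∀ m, ((‖A m‖⁻¹ : ℝ) : ℂ) • A m ∈ Metric.sphere (0 : Mat n) 1 := fun m => by
    simp [norm_smul, hne m]
  obtain ⟨B, hB, φ, hφ, hlim⟩ := (isCompact_sphere (0 : Mat n) 1).tendsto_subseq hsphere
  have hc : Tendsto (fun k => ((‖A (φ k)‖⁻¹ : ℝ) : ℂ)) atTop (𝓝 0) := by
    rw [← Complex.ofReal_zero]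
    exact (Complex.continuous_ofReal.tendsto _).comp
      (tendsto_inv_atTop_zero.comp (hnorm.comp hφ.tendsto_atTop))
  have hscaled : Tendsto (fun k => (((‖A (φ k)‖⁻¹ : ℝ) : ℂ) ^ 2) • gramMat n) atTop (𝓝 0) := by
    simpa using (hc.pow 2).smul_const (gramMat n)
  refine ⟨φ, fun k => ((‖A (φ k)‖⁻¹ : ℝ) : ℂ), B, hφ, fun k => by simp [hne], ?_, hlim, ?_, ?_⟩
  · rintro rfl
    simp at hB
  · have hcont : Continuous fun X : Mat n => Xᴴ * gramMat n * X := by fun_prop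
    refine tendsto_nhds_unique ((hcont.tendsto B).comp hlim) (hscaled.congr fun k => ?_)
    simp [smul_smul, sq, hA (φ k)]
  · have hcont : Continuous fun X : Mat n => X * gramMat n * Xᴴ := by fun_prop
    refine tendsto_nhds_unique ((hcont.tendsto B).comp hlim) (hscaled.congr fun k => ?_)
    simp [smul_smul, sq, mul_gramMat_mul_conjTranspose (hA (φ k))]

/-- Unitary lifts of pairwise distinct elements of a discrete group leave every bounded set. -/
lemma tendsto_norm_lift_atTop {n : ℕ} {G : Subgroup (PGLn n)} [DiscreteTopology ↥G]
    {γ : ℕ → G} (hγ : Function.Injective γ) {A : ℕ → GLn n} (hA : ∀ m, A m ∈ unitaryGL n)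
    (hmk : ∀ m, (QuotientGroup.mk (A m) : PGLn n) = γ m) :
    Tendsto (fun m => ‖(A m : Mat n)‖) atTop atTop := by
  have : ProperSpace (Mat n) := inferInstanceAs (ProperSpace (Fin (n + 1) → Fin (n + 1) → ℂ))
  by_contra hnot
  obtain ⟨R, hR⟩ : ∃ R : ℝ, ∃ᶠ m in atTop, ‖(A m : Mat n)‖ < R := by
    simpa [tendsto_atTop, Filter.Frequently] using hnot
  obtain ⟨L, -, φ, hφ, hlim⟩ := tendsto_subseq_of_frequently_bounded
    (Metric.isBounded_ball (x := (0 : Mat n)) (r := R)) (x := fun m => (A m : Mat n))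
    (hR.mono fun m hm => by simpa using hm)
  obtain ⟨U, hU⟩ := exists_tendsto_of_tendsto_val (fun k => hA (φ k)) hlim
  have hPGL : Tendsto (fun k => (γ (φ k) : PGLn n)) atTop (𝓝 (QuotientGroup.mk U)) :=
    ((QuotientGroup.continuous_mk.tendsto U).comp hU).congr fun k => hmk (φ k)
  have hquot : Tendsto (fun k => (γ (φ k))⁻¹ * γ (φ (k + 1))) atTop (𝓝 1) := by
    rw [tendsto_subtype_rng]
    simpa using hPGL.inv.mul (hPGL.comp (tendsto_add_atTop_nat 1))
  rw [nhds_discrete, tendsto_pure] at hquot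
  obtain ⟨k, hk⟩ := hquot.exists
  have := hφ.injective (hγ (inv_mul_eq_one.mp hk))
  omega

end

/-- A set of vectors invariant under nonzero scalars, so that it describes a set of points of
projective space. -/
def IsConic {n : ℕ} (S : Set (Vec n)) : Prop := ∀ (c : ℂ) (v : Vec n), c ≠ 0 → (c • v ∈ S ↔ v ∈ S)

lemma IsConic.rep_mk_mem_iff {n : ℕ} {S : Set (Vec n)} (hS : IsConic S) {v : Vec n} (hv : v ≠ 0) :
    (Projectivization.mk ℂ v hv).rep ∈ S ↔ v ∈ S := by
  obtain ⟨a, ha⟩ := Projectivization.exists_smul_eq_mk_rep ℂ v hv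
  rw [← ha]
  exact hS a v a.ne_zero

lemma IsConic.isOpen_setOf_rep_mem {n : ℕ} {S : Set (Vec n)} (hS : IsConic S) (ho : IsOpen S) :
    IsOpen {p : Pn n | p.rep ∈ S} := by
  refine isOpen_coinduced.mpr ?_
  convert! ho.preimage (continuous_subtype_val (p := fun v : Vec n => v ≠ 0)) using 1
  ext v
  exact hS.rep_mk_mem_iff v.2

lemma IsConic.compl {n : ℕ} {S : Set (Vec n)} (hS : IsConic S) : IsConic Sᶜ :=
  fun c v hc => not_congr (hS c v hc)

lemma isConic_submodule {n : ℕ} (W : Submodule ℂ (Vec n)) : IsConic (W : Set (Vec n)) :=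
  fun _ _ hc => W.smul_mem_iff hc

lemma isClosed_singleton_pn {n : ℕ} (p : Pn n) : IsClosed ({p} : Set (Pn n)) := by
  let W : Submodule ℂ (Vec n) := ℂ ∙ p.rep
  convert! ((isConic_submodule W).compl.isOpen_setOf_rep_mem
    W.closed_of_finiteDimensional.isOpen_compl).isClosed_compl using 1
  ext q
  have h : q = p ↔ q.rep ∈ W := by
    conv_lhs => rw [← q.mk_rep, ← p.mk_rep]
    rw [Projectivization.mk_eq_mk_iff', Submodule.mem_span_singleton]
  simpa using h

lemma tendsto_mk {n : ℕ} {q : ℕ → Vec n} {p : Vec n} (hq : ∀ k, q k ≠ 0) (hp : p ≠ 0)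
    (h : Tendsto q atTop (𝓝 p)) :
    Tendsto (fun k => Projectivization.mk ℂ (q k) (hq k)) atTop
      (𝓝 (Projectivization.mk ℂ p hp)) := by
  have hcont : Continuous (Projectivization.mk' ℂ : {v : Vec n // v ≠ 0} → Pn n) :=
    continuous_coinduced_rng
  exact (hcont.tendsto ⟨p, hp⟩).comp (f := fun k => ⟨q k, hq k⟩) (tendsto_subtype_rng.mpr h)

lemma UnifConvOn.eventually_mem {n : ℕ} {f : ℕ → Pn n → Pn n} {F : Pn n → Pn n} {K : Set (Pn n)}
    (h : UnifConvOn f F K) {a : Pn n} {U : Set (Pn n)} (hU : IsOpen U) (ha : a ∈ U) :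
    ∀ᶠ m in atTop, ∀ z ∈ K, F z = a → f m z ∈ U := by
  have hW := h (({a}ᶜ ×ˢ Set.univ) ∪ (Set.univ ×ˢ U))
    (((isClosed_singleton_pn a).isOpen_compl.prod isOpen_univ).union (isOpen_univ.prod hU))
    (fun y => by by_cases hy : y = a <;> simp [hy, ha])
  filter_upwards [hW] with m hm z hz hFz
  simpa [hFz] using hm z hz

lemma mk_mem_qKer {n : ℕ} {M : Mat n} {v : Vec n} (hv : v ≠ 0) :
    Projectivization.mk ℂ v hv ∈ qKer M ↔ M *ᵥ v = 0 :=
  (isConic_submodule (LinearMap.ker M.mulVecLin)).rep_mk_mem_iff hv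

lemma qMap_mk {n : ℕ} {M : Mat n} {v : Vec n} (hv : v ≠ 0) (hMv : M *ᵥ v ≠ 0) :
    qMap M (Projectivization.mk ℂ v hv) = Projectivization.mk ℂ (M *ᵥ v) hMv := by
  obtain ⟨a, ha⟩ := Projectivization.exists_smul_eq_mk_rep ℂ v hv
  have hrep : M *ᵥ (Projectivization.mk ℂ v hv).rep = a • M *ᵥ v := by
    rw [← ha, Matrix.mulVec_smul]
  have hne : M *ᵥ (Projectivization.mk ℂ v hv).rep ≠ 0 := by
    rw [hrep]; exact smul_ne_zero a.ne_zero hMv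
  rw [qMap, dif_pos hne, Projectivization.mk_eq_mk_iff]
  exact ⟨a, hrep.symm⟩

lemma GLn.mulVec_ne_zero {n : ℕ} (A : GLn n) {v : Vec n} (hv : v ≠ 0) : (A : Mat n) *ᵥ v ≠ 0 :=
  fun h => hv (glInj A (by simpa using h))

lemma actGL_mk {n : ℕ} (A : GLn n) {v : Vec n} (hv : v ≠ 0) :
    actGL A (Projectivization.mk ℂ v hv)
      = Projectivization.mk ℂ ((A : Mat n) *ᵥ v) (GLn.mulVec_ne_zero A hv) :=
  rfl

lemma act_mk {n : ℕ} (A : GLn n) : act (QuotientGroup.mk A : PGLn n) = actGL A := by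
  obtain ⟨h, hh⟩ := QuotientGroup.mk_out_eq_mul (Subgroup.center (GLn n)) A
  obtain ⟨a, ha⟩ := Matrix.GeneralLinearGroup.mem_center_iff_val_mem_range_scalar.mp h.2
  have hout : ∀ v, (Quotient.out (QuotientGroup.mk A : PGLn n)).val *ᵥ v = a • A.val *ᵥ v := by
    intro v
    rw [hh, Units.val_mul, ← ha, Matrix.scalar_apply, ← Matrix.mulVec_mulVec,
      ← Matrix.smul_one_eq_diagonal, Matrix.smul_mulVec, Matrix.one_mulVec, Matrix.mulVec_smul]
  funext p
  induction p using Projectivization.ind with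
  | h v hv =>
    rw [act, actGL_mk, actGL_mk, Projectivization.mk_eq_mk_iff']
    exact ⟨a, (hout v).symm⟩

section

variable {n : ℕ} {A : ℕ → GLn n} {M B : Mat n} {c : ℕ → ℂ} {φ : ℕ → ℕ} {x y : Vec n}

/-- Off the kernel of a rank-one limit of rescaled lifts, the quasi-projective limit takes its
values in the image of that rank-one limit. -/
lemma mulVec_mem_span_of_mulVec_ne_zero (hconv : QPConv (fun m => actGL (A m)) M)
    (hφ : StrictMono φ) (hc : ∀ k, c k ≠ 0)
    (hB : Tendsto (fun k => c k • (A (φ k) : Mat n)) atTop (𝓝 B))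
    (hBx : ∀ u, B *ᵥ u = herm n u y • x) {p : Vec n} (hp : B *ᵥ p ≠ 0) :
    M *ᵥ p ∈ ℂ ∙ x := by
  by_contra hmem
  have hMp : M *ᵥ p ≠ 0 := fun h => hmem (h ▸ Submodule.zero_mem _)
  have hp0 : p ≠ 0 := by rintro rfl; simp at hp
  obtain ⟨f, hf, hxf⟩ := Submodule.exists_le_ker_of_notMem hmem
  have hfx : f x = 0 := hxf (Submodule.mem_span_singleton_self x)
  have hfc : Continuous f := f.continuous_of_finiteDimensional
  set a := M *ᵥ p
  let S : Set (Vec n) := {v | ‖f a‖ * ‖v‖ < 2 * ‖f v‖ * ‖a‖}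
  have hS : IsConic S := fun t v ht => by
    have ht' : 0 < ‖t‖ := norm_pos_iff.mpr ht
    simp only [S, Set.mem_ofPred_eq, norm_smul, map_smul]
    rw [show ‖f a‖ * (‖t‖ * ‖v‖) = ‖t‖ * (‖f a‖ * ‖v‖) by ring,
      show 2 * (‖t‖ * ‖f v‖) * ‖a‖ = ‖t‖ * (2 * ‖f v‖ * ‖a‖) by ring, mul_lt_mul_iff_right₀ ht']
  have hSo : IsOpen S := isOpen_lt (by fun_prop) (by fun_prop)
  have haS : a ∈ S := by
    have : 0 < ‖f a‖ * ‖a‖ := mul_pos (norm_pos_iff.mpr hf) (norm_pos_iff.mpr hMp)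
    simp only [S, Set.mem_ofPred_eq]
    linarith
  have hev := (hconv {Projectivization.mk ℂ p hp0}
    (by simpa [mk_mem_qKer] using hMp) isCompact_singleton).eventually_mem
    (hS.isOpen_setOf_rep_mem hSo) ((hS.rep_mk_mem_iff hMp).mpr haS)
  have hlim : Tendsto (fun k => (c k • (A (φ k) : Mat n)) *ᵥ p) atTop (𝓝 (B *ᵥ p)) :=
    ((show Continuous fun X : Mat n => X *ᵥ p by fun_prop).tendsto B).comp hB
  have hmemS : ∀ᶠ k in atTop, (c k • (A (φ k) : Mat n)) *ᵥ p ∈ S := by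
    filter_upwards [hφ.tendsto_atTop.eventually hev] with k hk
    rw [Matrix.smul_mulVec, hS _ _ (hc k)]
    have hmem' := hk _ (Set.mem_singleton _) (qMap_mk hp0 hMp)
    exact (hS.rep_mk_mem_iff (GLn.mulVec_ne_zero _ hp0)).mp hmem'
  have hcl : IsClosed {v : Vec n | ‖f a‖ * ‖v‖ ≤ 2 * ‖f v‖ * ‖a‖} :=
    isClosed_le (by fun_prop) (by fun_prop)
  have hle : ‖f a‖ * ‖B *ᵥ p‖ ≤ 2 * ‖f (B *ᵥ p)‖ * ‖a‖ :=
    hcl.mem_of_tendsto hlim (hmemS.mono fun _ hk => by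
      simp only [S, Set.mem_ofPred_eq] at hk ⊢
      exact hk.le)
  have hpos : 0 < ‖f a‖ * ‖B *ᵥ p‖ := mul_pos (norm_pos_iff.mpr hf) (norm_pos_iff.mpr hp)
  rw [hBx p] at hle hpos
  rw [map_smul, hfx] at hle
  simp only [smul_zero, norm_zero, mul_zero, zero_mul] at hle
  exact absurd hle (not_le.mpr hpos)

lemma mulVec_mem_span (hconv : QPConv (fun m => actGL (A m)) M)
    (hφ : StrictMono φ) (hc : ∀ k, c k ≠ 0)
    (hB : Tendsto (fun k => c k • (A (φ k) : Mat n)) atTop (𝓝 B))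
    (hBx : ∀ u, B *ᵥ u = herm n u y • x) {w : Vec n} (hw : B *ᵥ w ≠ 0) (p : Vec n) :
    M *ᵥ p ∈ ℂ ∙ x := by
  by_cases hp : B *ᵥ p = 0
  · have h := mulVec_mem_span_of_mulVec_ne_zero hconv hφ hc hB hBx (p := p + w)
      (by rwa [Matrix.mulVec_add, hp, zero_add])
    rw [Matrix.mulVec_add] at h
    exact (Submodule.add_mem_iff_left _
      (mulVec_mem_span_of_mulVec_ne_zero hconv hφ hc hB hBx hw)).mp h
  · exact mulVec_mem_span_of_mulVec_ne_zero hconv hφ hc hB hBx hp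

/-- Near a point of the kernel of the rank-one limit there are points which the lifts send into a
fixed hyperplane avoiding `x`, so there the convergence towards `x` cannot be uniform. -/
lemma mulVec_eq_zero_of_mulVec_eq_zero (hconv : QPConv (fun m => actGL (A m)) M)
    (hφ : StrictMono φ) (hc : ∀ k, c k ≠ 0)
    (hB : Tendsto (fun k => c k • (A (φ k) : Mat n)) atTop (𝓝 B)) (hx : x ≠ 0)
    (hBx : ∀ u, B *ᵥ u = herm n u y • x) {w : Vec n} (hw : B *ᵥ w ≠ 0) {p : Vec n}
    (hp : B *ᵥ p = 0) : M *ᵥ p = 0 := by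
  by_contra hMp
  have hp0 : p ≠ 0 := by rintro rfl; simp at hMp
  obtain ⟨i, hi⟩ := Function.ne_iff.mp hx
  have hwi : (B *ᵥ w) i ≠ 0 := by
    rw [hBx] at hw ⊢
    exact mul_ne_zero (fun h => hw (by rw [h, zero_smul])) hi
  let Bk : ℕ → Mat n := fun k => c k • (A (φ k) : Mat n)
  have hlim : ∀ v, Tendsto (fun k => (Bk k *ᵥ v) i) atTop (𝓝 ((B *ᵥ v) i)) := fun v =>
    ((show Continuous fun X : Mat n => (X *ᵥ v) i by fun_prop).tendsto B).comp hB
  let q : ℕ → Vec n := fun k => p - ((Bk k *ᵥ p) i / (Bk k *ᵥ w) i) • w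
  have hq : Tendsto q atTop (𝓝 p) := by
    have h := (tendsto_const_nhds (x := p)).sub (((hlim p).div (hlim w) hwi).smul_const w)
    simpa [hp] using h
  have hMq : ∀ᶠ k in atTop, M *ᵥ q k ≠ 0 :=
    (((show Continuous fun v : Vec n => M *ᵥ v by fun_prop).tendsto p).comp hq).eventually_ne hMp
  have hAq : ∀ᶠ k in atTop, ((A (φ k) : Mat n) *ᵥ q k) i = 0 := by
    filter_upwards [(hlim w).eventually_ne hwi] with k hk
    have h : (Bk k *ᵥ q k) i = 0 := by
      simp [q, Matrix.mulVec_sub, Matrix.mulVec_smul, hk]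
    simpa [Bk, Matrix.smul_mulVec, hc k] using h
  obtain ⟨N, hN⟩ := eventually_atTop.mp (hMq.and hAq)
  let r : ℕ → Vec n := fun k => q (k + N)
  have hMr : ∀ k, M *ᵥ r k ≠ 0 := fun k => (hN (k + N) (Nat.le_add_left _ _)).1
  have hr0 : ∀ k, r k ≠ 0 := fun k h => hMr k (by rw [h, Matrix.mulVec_zero])
  have hr := tendsto_mk hr0 hp0 (hq.comp (tendsto_add_atTop_nat N))
  let S : Set (Vec n) := {v | v i ≠ 0}
  have hS : IsConic S := fun t v ht => by simp [S, ht]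
  have hSo : IsOpen S := isOpen_ne_fun (by fun_prop) (by fun_prop)
  have hev := (hconv _ (by
      rintro _ (rfl | ⟨k, rfl⟩)
      · simpa [mk_mem_qKer] using hMp
      · simpa [mk_mem_qKer] using hMr k) hr.isCompact_insert_range).eventually_mem
    (hS.isOpen_setOf_rep_mem hSo) ((hS.rep_mk_mem_iff hx).mpr hi)
  obtain ⟨k, hk⟩ := ((hφ.tendsto_atTop.comp (tendsto_add_atTop_nat N)).eventually hev).exists
  have hmem := hk _ (Set.mem_insert_of_mem _ ⟨k, rfl⟩) (by
    rw [qMap_mk (hr0 k) (hMr k), Projectivization.mk_eq_mk_iff']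
    exact Submodule.mem_span_singleton.mp (mulVec_mem_span hconv hφ hc hB hBx hw (r k)))
  exact (hS.rep_mk_mem_iff (GLn.mulVec_ne_zero _ (hr0 k))).mp hmem
    (hN (k + N) (Nat.le_add_left _ _)).2

lemma herm_add_smul_left (u v w : Vec n) (t : ℂ) :
    herm n (u + t • v) w = herm n u w + t * herm n v w := by
  simp [herm_eq_dotProduct, Matrix.mulVec_add, Matrix.mulVec_smul]

/-- The kernel of the quasi-projective limit is the orthogonal complement of `y`. -/
lemma mulVec_eq_zero_iff_herm_eq_zero (hM : M ≠ 0) (hconv : QPConv (fun m => actGL (A m)) M)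
    (hφ : StrictMono φ) (hc : ∀ k, c k ≠ 0)
    (hB : Tendsto (fun k => c k • (A (φ k) : Mat n)) atTop (𝓝 B)) (hB0 : B ≠ 0) (hx : x ≠ 0)
    (hBx : ∀ u, B *ᵥ u = herm n u y • x) (u : Vec n) : M *ᵥ u = 0 ↔ herm n u y = 0 := by
  obtain ⟨w, hw⟩ : ∃ w, B *ᵥ w ≠ 0 := by
    by_contra! h
    exact hB0 (Matrix.ext_of_mulVec_single fun i => by rw [h, Matrix.zero_mulVec])
  have hker : ∀ v, herm n v y = 0 → M *ᵥ v = 0 := fun v hv =>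
    mulVec_eq_zero_of_mulVec_eq_zero hconv hφ hc hB hx hBx hw (by rw [hBx, hv, zero_smul])
  refine ⟨fun hu => ?_, hker u⟩
  by_contra hne
  refine hM (Matrix.ext_of_mulVec_single fun i => ?_)
  have h := hker (Pi.single i 1 + (-(herm n (Pi.single i 1) y / herm n u y)) • u) (by
    rw [herm_add_smul_left]; field_simp; ring)
  rw [Matrix.zero_mulVec]
  simpa only [Matrix.mulVec_add, Matrix.mulVec_smul, hu, smul_zero, add_zero] using h

lemma continuous_herm_self : Continuous fun v : Vec n => (herm n v v).re := by
  unfold herm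
  fun_prop

lemma herm_smul_self (t : ℂ) (v : Vec n) : herm n (t • v) (t • v) = (‖t‖ ^ 2 : ℝ) * herm n v v := by
  have h := herm_sub_smul 0 v (-t)
  simp only [neg_smul, zero_sub, neg_neg] at h
  rw [h]
  simp [herm_eq_dotProduct, Complex.mul_conj, Complex.normSq_eq_norm_sq]

lemma rep_nonpos_of_mem_closure_Hball {p : Pn n} (hp : p ∈ closure (Hball n)) :
    (herm n p.rep p.rep).re ≤ 0 := by
  have hconic : ∀ t : ℂ, ∀ v : Vec n, t ≠ 0 →
      ((herm n (t • v) (t • v)).re ≤ 0 ↔ (herm n v v).re ≤ 0) := fun t v ht => by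
    rw [herm_smul_self, Complex.re_ofReal_mul]
    exact mul_nonpos_iff_pos_imp_nonpos.trans (by simp [ht])
  let S : Set (Vec n) := {v | (herm n v v).re ≤ 0}
  have hS : IsConic S := hconic
  have hcl : IsClosed {p : Pn n | p.rep ∈ S} := isOpen_compl_iff.mp
    (hS.compl.isOpen_setOf_rep_mem
      (isClosed_le continuous_herm_self continuous_const).isOpen_compl)
  refine closure_minimal ?_ hcl hp
  rintro _ ⟨v, hv, rfl, hneg⟩
  exact (hS.rep_mk_mem_iff hv).mpr hneg.le

lemma mk_mem_closure_Hball (hy : y ≠ 0) (hyy : herm n y y = 0) :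
    Projectivization.mk ℂ y hy ∈ closure (Hball n) := by
  have hy0 := zeroth_ne_zero_of_isotropic hy hyy
  let t : ℕ → ℝ := fun k => 1 / ((k : ℝ) + 1)
  have ht0 : ∀ k, 0 < t k := fun k => by positivity
  let q : ℕ → Vec n := fun k => y + (t k : ℂ) • Pi.single 0 (y 0)
  have hq0 : ∀ k, q k 0 = ((1 + t k : ℝ) : ℂ) * y 0 := fun k => by
    simp [q]; ring
  have hqs : ∀ k (j : Fin n), q k j.succ = y j.succ := fun k j => by simp [q]
  have hqne : ∀ k, q k ≠ 0 := fun k h => by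
    have h' := hq0 k
    rw [h, Pi.zero_apply, eq_comm, mul_eq_zero] at h'
    rcases h' with h' | h'
    · have := ht0 k
      rw [Complex.ofReal_eq_zero] at h'
      linarith
    · exact hy0 h'
  have hlim : Tendsto q atTop (𝓝 y) := by
    have h : Tendsto t atTop (𝓝 0) := tendsto_one_div_add_atTop_nhds_zero_nat
    have h' := ((Complex.continuous_ofReal.tendsto 0).comp h).smul_const
      (Pi.single 0 (y 0) : Vec n)
    simpa [q] using (tendsto_const_nhds (x := y)).add h'
  refine mem_closure_of_tendsto (tendsto_mk hqne hy hlim) (Eventually.of_forall fun k => ?_)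
  refine ⟨q k, hqne k, rfl, ?_⟩
  have hyy' := congrArg Complex.re hyy
  rw [herm_self, Complex.ofReal_re, Complex.zero_re] at hyy'
  rw [herm_self, Complex.ofReal_re, hq0]
  simp only [hqs, norm_mul, Complex.norm_real, Real.norm_eq_abs, mul_pow, sq_abs]
  have hy2 : 0 < ‖y 0‖ ^ 2 := by positivity
  nlinarith [mul_pos (ht0 k) hy2, mul_pos (mul_pos (ht0 k) (ht0 k)) hy2]

end

/-- If a sequence of pairwise distinct elements of a discrete subgroup
`G` of `PU(1,n)` converges as quasi-projective transformations to `γ`, then `Ker(γ)` is a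
complex projective hyperplane tangent to `∂𝐇ⁿ_ℂ`: its intersection with the closure of
`𝐇ⁿ_ℂ` is exactly one point, which lies on `∂𝐇ⁿ_ℂ`. -/
theorem qp_limit_kernel_is_tangent_hyperplane
    (n : ℕ) (hn : 1 ≤ n) (G : Subgroup (PGLn n))
    (hPU : (G : Set (PGLn n)) ⊆ PUset n) (hdisc : DiscreteTopology ↥G)
    (γ : ℕ → G) (hγ : Function.Injective γ) (M : Mat n) (hM : M ≠ 0)
    (hconv : QPConv (fun m => act (γ m : PGLn n)) M) :
    IsProjHyperplane (qKer M) ∧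
      ∃ q ∈ Hbdry n, qKer M ∩ closure (Hball n) = {q} := by
  choose A hA hmk using fun m => hPU (γ m).2
  have hact : (fun m => act (γ m : PGLn n)) = fun m => actGL (A m) :=
    funext fun m => by rw [← hmk m, act_mk]
  rw [hact] at hconv
  obtain ⟨φ, c, B, hφ, hc, hB0, hB, h₁, h₂⟩ := exists_rescaled_limit
    (fun m => conjTranspose_mul_gramMat_mul (hA m)) (tendsto_norm_lift_atTop hγ hA hmk)
  obtain ⟨x, y, hx, hy, hyy, hBx⟩ := exists_isotropic_rank_one hB0 h₁ h₂
  have hker := mulVec_eq_zero_iff_herm_eq_zero hM hconv hφ hc hB hB0 hx hBx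
  refine ⟨⟨LinearMap.ker M.mulVecLin, ?_, rfl⟩, Projectivization.mk ℂ y hy, ⟨y, hy, rfl, hyy⟩, ?_⟩
  · let f : Module.Dual ℂ (Vec n) :=
      { toFun := fun u => herm n u y
        map_add' := fun u v => by simpa using herm_add_smul_left u v y 1
        map_smul' := fun t u => by simpa [herm] using herm_add_smul_left 0 u y t }
    have hf : f ≠ 0 := fun h => hB0 (Matrix.ext_of_mulVec_single fun i => by
      rw [hBx, show herm n (Pi.single i 1) y = 0 from LinearMap.congr_fun h _, zero_smul,
        Matrix.zero_mulVec])
    have hfM : LinearMap.ker M.mulVecLin = LinearMap.ker f := by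
      ext u
      exact hker u
    have hrank := Module.Dual.finrank_ker_add_one_of_ne_zero hf
    rw [hfM]
    simpa using hrank
  · ext p
    constructor
    · rintro ⟨hpK, hpcl⟩
      rw [Set.mem_singleton_iff, ← p.mk_rep, Projectivization.mk_eq_mk_iff']
      exact ⟨_, (eq_smul_of_herm_eq_zero hy hyy ((hker _).mp hpK)
        (rep_nonpos_of_mem_closure_Hball hpcl)).symm⟩
    · rintro rfl
      exact ⟨(mk_mem_qKer hy).mpr ((hker y).mpr hyy), mk_mem_closure_Hball hy hyy⟩
end

section
/- Let n ≥ 1 and let G be a discrete subgroup of PU(1,n). For any two points x, y ∈ 𝐇ⁿ_ℂ, the set of accumulation points in ℙⁿ_ℂ of the orbit G·x equals the set of accumulation points of the orbit G·y. In particular, the Chen–Greenberg limit set Λ_CG(G) does not depend on the choice of orbit. -/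
open Filter Topology Matrix

/-- A sequence of pairwise distinct elements of a discrete subgroup does not converge, even in the
ambient topological group. -/
theorem Subgroup.not_tendsto_of_injective {Γ : Type*} [Group Γ] [TopologicalSpace Γ]
    [IsTopologicalGroup Γ] (G : Subgroup Γ) [DiscreteTopology G] {g : ℕ → G}
    (hg : Function.Injective g) (a : Γ) : ¬ Tendsto (fun m => (g m : Γ)) atTop (𝓝 a) := by
  intro h
  have h1 : Tendsto (fun m => (((g m)⁻¹ * g (m + 1) : G) : Γ)) atTop (𝓝 ((1 : G) : Γ)) := by
    simpa using h.inv.mul (h.comp (tendsto_add_atTop_nat 1))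
  have h2 : Tendsto (fun m => (g m)⁻¹ * g (m + 1)) atTop (𝓝 (1 : G)) :=
    IsInducing.subtypeVal.tendsto_nhds_iff.2 h1
  rw [nhds_discrete, tendsto_pure] at h2
  obtain ⟨m, hm⟩ := h2.exists
  have := hg (inv_mul_eq_one.1 hm)
  omega

section Hermitian

variable {n : ℕ}

theorem herm_self_re (v : Vec n) :
    (herm n v v).re = -‖v 0‖ ^ 2 + ∑ j : Fin n, ‖v j.succ‖ ^ 2 := by
  simp only [herm, Complex.mul_conj', Complex.add_re, Complex.neg_re, Complex.re_sum]
  norm_cast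

theorem herm_single_zero_right (u : Vec n) : herm n u (Pi.single 0 1) = -u 0 := by
  simp [herm]

theorem norm_herm_comm (u v : Vec n) : ‖herm n u v‖ = ‖herm n v u‖ := by
  rw [← Complex.norm_conj (herm n u v)]
  simp [herm, mul_comm]

theorem herm_smul_left (c : ℂ) (u v : Vec n) : herm n (c • u) v = c * herm n u v := by
  simp only [herm, Pi.smul_apply, smul_eq_mul, mul_add, Finset.mul_sum]
  congr 1
  · ring
  · exact Finset.sum_congr rfl fun _ _ => by ring

theorem norm_herm_smul_smul (c d : ℂ) (u v : Vec n) :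
    ‖herm n (c • u) (d • v)‖ = ‖c‖ * ‖d‖ * ‖herm n u v‖ := by
  rw [herm_smul_left, norm_mul, norm_herm_comm, herm_smul_left, norm_mul, norm_herm_comm,
    mul_assoc]

theorem herm_smul_self_re (c : ℂ) (u : Vec n) :
    (herm n (c • u) (c • u)).re = ‖c‖ ^ 2 * (herm n u u).re := by
  simp only [herm_self_re, Pi.smul_apply, smul_eq_mul, norm_mul, mul_pow, mul_add, Finset.mul_sum]
  ring

/-- On non-positive vectors the zeroth coordinate dominates all the others. -/
theorem norm_apply_le_of_herm_nonpos {u : Vec n} (hu : (herm n u u).re ≤ 0) (i : Fin (n + 1)) :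
    ‖u i‖ ≤ ‖u 0‖ := by
  refine Fin.cases le_rfl (fun j => ?_) i
  rw [herm_self_re] at hu
  have := Finset.single_le_sum (f := fun j : Fin n => ‖u j.succ‖ ^ 2)
    (fun j _ => by positivity) (Finset.mem_univ j)
  exact (sq_le_sq₀ (norm_nonneg _) (norm_nonneg _)).1 (by linarith)

/-- Reversed Cauchy–Schwarz estimate: the zeroth coordinates of non-positive vectors are comparable
up to their Hermitian product. -/
theorem norm_zero_mul_le_of_herm_nonpos {v w : Vec n} (hv : (herm n v v).re ≤ 0)
    (hw : (herm n w w).re ≤ 0) :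
    ‖w 0‖ * (-(herm n v v).re) ≤ 2 * ‖v 0‖ * ‖herm n v w‖ := by
  rw [herm_self_re] at hv hw ⊢
  set s := √(∑ j : Fin n, ‖v j.succ‖ ^ 2)
  set t := √(∑ j : Fin n, ‖w j.succ‖ ^ 2)
  have hs : s ^ 2 = ∑ j : Fin n, ‖v j.succ‖ ^ 2 := Real.sq_sqrt (by positivity)
  have ht : t ^ 2 = ∑ j : Fin n, ‖w j.succ‖ ^ 2 := Real.sq_sqrt (by positivity)
  have hs0 : 0 ≤ s := Real.sqrt_nonneg _
  have ht0 : 0 ≤ t := Real.sqrt_nonneg _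
  rw [← hs] at hv ⊢
  rw [← ht] at hw
  have hsv : s ≤ ‖v 0‖ := abs_le_of_sq_le_sq' (by linarith) (norm_nonneg _) |>.2
  have htw : t ≤ ‖w 0‖ := abs_le_of_sq_le_sq' (by linarith) (norm_nonneg _) |>.2
  have hsum : ‖∑ j : Fin n, v j.succ * (starRingEnd ℂ) (w j.succ)‖ ≤ s * t := by
    refine (norm_sum_le _ _).trans ?_
    simpa using Real.sum_mul_le_sqrt_mul_sqrt Finset.univ
      (fun j : Fin n => ‖v j.succ‖) (fun j => ‖w j.succ‖)
  have hherm : ‖v 0‖ * ‖w 0‖ ≤ ‖herm n v w‖ + s * t := by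
    have := norm_sub_le (herm n v w) (∑ j : Fin n, v j.succ * (starRingEnd ℂ) (w j.succ))
    rw [herm, add_sub_cancel_right, norm_neg, norm_mul, Complex.norm_conj, ← herm] at this
    linarith
  have h1 : s * t ≤ s * ‖w 0‖ := by gcongr
  have h2 : ‖w 0‖ * (‖v 0‖ - s) ≤ ‖herm n v w‖ := by nlinarith
  have h3 : ‖w 0‖ * (‖v 0‖ - s) * (‖v 0‖ + s) ≤ ‖herm n v w‖ * (2 * ‖v 0‖) := by
    gcongr
    linarith
  linarith

theorem norm_sub_sq_le_of_herm_nonpos {p q : Vec n} (hp : p 0 = 1) (hq : q 0 = 1)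
    (hpn : (herm n p p).re ≤ 0) (hqn : (herm n q q).re ≤ 0) (i : Fin (n + 1)) :
    ‖p i - q i‖ ^ 2 ≤ 2 * ‖herm n p q‖ := by
  refine Fin.cases (by simp [hp, hq]) (fun j => ?_) i
  have hsum : ∑ j : Fin n, ‖p j.succ - q j.succ‖ ^ 2 =
      (herm n p p).re + (herm n q q).re - 2 * (herm n p q).re := by
    simp only [herm_self_re, hp, hq]
    simp only [herm, hp, hq, Complex.add_re, Complex.re_sum, Finset.mul_sum, mul_add]
    have h (a b : ℂ) : ‖a - b‖ ^ 2 = ‖a‖ ^ 2 + ‖b‖ ^ 2 - 2 * (a * (starRingEnd ℂ) b).re := by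
      simp only [← Complex.normSq_eq_norm_sq]
      exact Complex.normSq_sub a b
    simp only [h, Finset.sum_add_distrib, Finset.sum_sub_distrib]
    simp
    ring
  have hj := Finset.single_le_sum (f := fun j : Fin n => ‖p j.succ - q j.succ‖ ^ 2)
    (fun j _ => by positivity) (Finset.mem_univ j)
  have := (abs_le.1 (Complex.abs_re_le_norm (herm n p q))).1
  linarith

end Hermitian

section Action

variable {n : ℕ}

theorem act_coe_mk (A : GLn n) (v : Vec n) (hv : v ≠ 0) (hAv : (A : Mat n) *ᵥ v ≠ 0) :
    act (A : PGLn n) (Projectivization.mk ℂ v hv) =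
      Projectivization.mk ℂ ((A : Mat n) *ᵥ v) hAv := by
  obtain ⟨B, hB⟩ := QuotientGroup.mk_out_eq_mul (Subgroup.center (GLn n)) A
  obtain ⟨c, hc⟩ := Matrix.GeneralLinearGroup.mem_center_iff_val_mem_range_scalar.1 B.2
  simp only [act, actGL]
  erw [Projectivization.map_mk]
  rw [Projectivization.mk_eq_mk_iff']
  refine ⟨c, ?_⟩
  erw [hB]
  simp [← hc]

theorem inv_mem_unitaryGL {A : GLn n} (hA : A ∈ unitaryGL n) : A⁻¹ ∈ unitaryGL n := by
  intro u v
  rw [← hA]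
  simp [Matrix.mulVec_mulVec]

theorem norm_mulVec_single_zero_apply_zero_inv {A : GLn n} (hA : A ∈ unitaryGL n) :
    ‖(((A⁻¹ : GLn n) : Mat n) *ᵥ Pi.single 0 1) 0‖ = ‖((A : Mat n) *ᵥ Pi.single 0 1) 0‖ := by
  have h := hA (((A⁻¹ : GLn n) : Mat n) *ᵥ Pi.single 0 1) (Pi.single 0 1)
  rw [Matrix.mulVec_mulVec, ← Units.val_mul, mul_inv_cancel, Units.val_one, Matrix.one_mulVec,
    herm_single_zero_right] at h
  rw [← norm_neg, ← h, norm_herm_comm, herm_single_zero_right, norm_neg]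

/-- A unitary transformation moving a negative vector `v` a bounded amount is itself bounded. -/
theorem exists_norm_entry_le {v : Vec n} (hv : (herm n v v).re < 0) (R : ℝ) :
    ∃ C : ℝ, ∀ A ∈ unitaryGL n, ‖((A : Mat n) *ᵥ v) 0‖ ≤ R → ∀ i j, ‖(A : Mat n) i j‖ ≤ C := by
  have key (w : Vec n) (hw : (herm n w w).re ≤ 0) : ∃ C : ℝ, ∀ A ∈ unitaryGL n,
      ‖((A : Mat n) *ᵥ v) 0‖ ≤ R → ∀ i, ‖((A : Mat n) *ᵥ w) i‖ ≤ C := by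
    refine ⟨2 * R * ‖herm n v w‖ / (-(herm n v v).re), fun A hA hR i => ?_⟩
    refine (norm_apply_le_of_herm_nonpos (by rwa [hA]) i).trans ?_
    rw [le_div_iff₀ (by linarith)]
    have := norm_zero_mul_le_of_herm_nonpos (v := (A : Mat n) *ᵥ v) (w := (A : Mat n) *ᵥ w)
      (by rw [hA]; exact hv.le) (by rwa [hA])
    rw [hA, hA] at this
    refine this.trans ?_
    gcongr
  have h0 : (herm n (Pi.single 0 1) (Pi.single 0 1)).re ≤ 0 := by
    simp [herm_single_zero_right]
  have hj (j : Fin n) : (herm n (Pi.single 0 1 + Pi.single j.succ 1)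
      (Pi.single 0 1 + Pi.single j.succ 1)).re ≤ 0 := by
    rw [herm_self_re]
    simp [Pi.single_apply, Fin.succ_ne_zero, apply_ite]
  obtain ⟨C₀, hC₀⟩ := key _ h0
  choose C hC using fun j => key _ (hj j)
  refine ⟨|C₀| + ∑ j, (|C j| + |C₀|), fun A hA hR i j => ?_⟩
  have hcol (i j) : ((A : Mat n) *ᵥ Pi.single j 1) i = (A : Mat n) i j := by simp
  have hA0 := hC₀ A hA hR i
  refine Fin.cases ?_ (fun j => ?_) j
  · have : 0 ≤ ∑ j, (|C j| + |C₀|) := by positivity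
    rw [hcol] at hA0
    linarith [le_abs_self C₀]
  · have h1 := hC j A hA hR i
    rw [Matrix.mulVec_add, Pi.add_apply, hcol, hcol] at h1
    rw [hcol] at hA0
    have h2 := Finset.single_le_sum (f := fun j => |C j| + |C₀|)
      (fun j _ => by positivity) (Finset.mem_univ j)
    have h3 := norm_sub_le ((A : Mat n) i 0 + (A : Mat n) i j.succ) ((A : Mat n) i 0)
    rw [add_sub_cancel_left] at h3
    linarith [le_abs_self C₀, le_abs_self (C j), abs_nonneg C₀]

theorem tendsto_norm_mulVec_apply_zero {G : Subgroup (PGLn n)} (hG : DiscreteTopology G)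
    {g : ℕ → G} (hg : Function.Injective g) {A : ℕ → GLn n} (hA : ∀ m, A m ∈ unitaryGL n)
    (hAg : ∀ m, (A m : PGLn n) = g m) {v : Vec n} (hv : (herm n v v).re < 0) :
    Tendsto (fun m => ‖((A m : Mat n) *ᵥ v) 0‖) atTop atTop := by
  by_contra hcon
  obtain ⟨R, hR⟩ : ∃ R : ℝ, ∃ᶠ m in atTop, ‖((A m : Mat n) *ᵥ v) 0‖ ≤ R := by
    simp only [tendsto_atTop, not_forall, not_eventually, not_le] at hcon
    exact hcon.imp fun R h => h.mono fun _ => le_of_lt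
  obtain ⟨φ, hφ, hφR⟩ := extraction_of_frequently_atTop hR
  obtain ⟨C, hC⟩ := exists_norm_entry_le hv R
  have h0 : (herm n (Pi.single 0 1) (Pi.single 0 1)).re < 0 := by
    simp [herm_single_zero_right]
  obtain ⟨C', hC'⟩ := exists_norm_entry_le h0 C
  have hcpt (c : ℝ) : IsCompact {M : Mat n | ∀ i j, ‖M i j‖ ≤ c} := by
    have h : IsCompact {M : Fin (n + 1) → Fin (n + 1) → ℂ | ∀ i j, ‖M i j‖ ≤ c} := by
      convert isCompact_univ_pi fun _ : Fin (n + 1) => isCompact_univ_pi fun _ : Fin (n + 1) =>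
        isCompact_closedBall (0 : ℂ) c using 1
      ext M
      simp [Set.mem_pi]
    exact h
  have : FirstCountableTopology (Mat n) :=
    inferInstanceAs (FirstCountableTopology (Fin (n + 1) → Fin (n + 1) → ℂ))
  obtain ⟨⟨M, N⟩, -, ψ, hψ, hlim⟩ := ((hcpt C).prod (hcpt C')).tendsto_subseq
    (x := fun k => ((A (φ k) : Mat n), (((A (φ k))⁻¹ : GLn n) : Mat n))) fun k => by
      have h1 := hC _ (hA (φ k)) (hφR k)
      refine ⟨h1, hC' _ (inv_mem_unitaryGL (hA _)) ?_⟩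
      rw [norm_mulVec_single_zero_apply_zero_inv (hA _)]
      simpa using h1 0 0
  have hM : Tendsto (fun k => (A (φ (ψ k)) : Mat n)) atTop (𝓝 M) :=
    (continuous_fst.tendsto _).comp hlim
  have hN : Tendsto (fun k => (((A (φ (ψ k)))⁻¹ : GLn n) : Mat n)) atTop (𝓝 N) :=
    (continuous_snd.tendsto _).comp hlim
  have hMN : M * N = 1 := tendsto_nhds_unique (hM.mul hN) (by simp)
  have hNM : N * M = 1 := tendsto_nhds_unique (hN.mul hM) (by simp)
  let U : GLn n := ⟨M, N, hMN, hNM⟩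
  have hU : Tendsto (fun k => A (φ (ψ k))) atTop (𝓝 U) := by
    rw [Units.isInducing_embedProduct.tendsto_nhds_iff]
    exact hM.prodMk_nhds ((MulOpposite.continuous_op.tendsto _).comp hN)
  refine G.not_tendsto_of_injective (g := fun k => g (φ (ψ k)))
    (hg.comp (hφ.comp hψ).injective) (U : PGLn n) ?_
  simpa only [← hAg] using! (QuotientGroup.continuous_mk.tendsto U).comp hU

end Action

section Chart

variable {n : ℕ}

theorem continuous_projectivization_mk' :
    Continuous (Projectivization.mk' ℂ : {v : Vec n // v ≠ 0} → Pn n) :=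
  continuous_quot_mk

/-- The coordinates `u ↦ conj (u 0) • u / ‖u‖²`, which are globally defined and continuous on
projective space. -/
noncomputable def conjCoord (n : ℕ) : Pn n → Vec n :=
  Projectivization.lift
    (fun v => ((∑ i, ‖v.1 i‖ ^ 2 : ℝ) : ℂ)⁻¹ • (starRingEnd ℂ) (v.1 0) • v.1) (by
    rintro ⟨a, ha⟩ ⟨b, hb⟩ t rfl
    have ht : t ≠ 0 := by rintro rfl; simp at ha
    ext i
    have h : ((∑ i, ‖t • b i‖ ^ 2 : ℝ) : ℂ) =
        t * (starRingEnd ℂ) t * ((∑ i, ‖b i‖ ^ 2 : ℝ) : ℂ) := by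
      simp only [smul_eq_mul, norm_mul, mul_pow, ← Finset.mul_sum, Complex.mul_conj']
      push_cast
      rfl
    have ht' : (starRingEnd ℂ) t ≠ 0 := by simpa
    simp only [Pi.smul_apply, smul_eq_mul, map_mul] at h ⊢
    rw [h]
    field_simp)

theorem conjCoord_mk (v : Vec n) (hv : v ≠ 0) : conjCoord n (Projectivization.mk ℂ v hv) =
    ((∑ i, ‖v i‖ ^ 2 : ℝ) : ℂ)⁻¹ • (starRingEnd ℂ) (v 0) • v :=
  rfl

theorem sum_norm_sq_pos {v : Vec n} (hv : v ≠ 0) : 0 < ∑ i, ‖v i‖ ^ 2 := by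
  obtain ⟨i, hi⟩ := Function.ne_iff.1 hv
  exact Finset.sum_pos' (fun _ _ => by positivity)
    ⟨i, Finset.mem_univ i, pow_pos (norm_pos_iff.2 hi) 2⟩

theorem continuous_conjCoord : Continuous (conjCoord n) := by
  refine continuous_quot_lift _ ?_
  have hcoord (i : Fin (n + 1)) : Continuous fun v : {v : Vec n // v ≠ 0} => v.1 i :=
    (continuous_apply i).comp continuous_subtype_val
  have hsum : Continuous fun v : {v : Vec n // v ≠ 0} => ((∑ i, ‖v.1 i‖ ^ 2 : ℝ) : ℂ) :=
    Complex.continuous_ofReal.comp (continuous_finsetSum _ fun i _ => (hcoord i).norm.pow 2)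
  refine (hsum.inv₀ fun v => ?_).smul
    ((Complex.continuous_conj.comp (hcoord 0)).smul continuous_subtype_val)
  exact_mod_cast (sum_norm_sq_pos v.2).ne'

/-- Convergence of non-positive points in projective space is convergence in the affine chart
given by the zeroth coordinate. -/
theorem tendsto_of_tendsto_mk {p : ℕ → Vec n} (hp0 : ∀ m, p m 0 = 1)
    (hpn : ∀ m, (herm n (p m) (p m)).re ≤ 0) (hp : ∀ m, p m ≠ 0) {z : Pn n}
    (hz : Tendsto (fun m => Projectivization.mk ℂ (p m) (hp m)) atTop (𝓝 z)) :
    ∃ ζ : Vec n, ∃ hζ : ζ ≠ 0, z = Projectivization.mk ℂ ζ hζ ∧ Tendsto p atTop (𝓝 ζ) := by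
  induction z using Projectivization.ind with
  | h ζ hζ =>
  have hF := (continuous_conjCoord.tendsto _).comp hz
  simp only [Function.comp_def, conjCoord_mk, hp0] at hF
  rw [tendsto_pi_nhds] at hF
  have hF0 := hF 0
  simp only [Pi.smul_apply, hp0, smul_eq_mul, map_one, mul_one, one_smul] at hF hF0
  have hsum (m) : ∑ i, ‖p m i‖ ^ 2 ≤ 2 := by
    have := hpn m
    rw [herm_self_re, hp0] at this
    rw [Fin.sum_univ_succ, hp0]
    simp at this ⊢
    linarith
  have hζ0 : ζ 0 ≠ 0 := by
    intro h
    rw [h] at hF0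
    have h1 := hF0.norm
    simp only [mul_zero, norm_zero] at h1
    have h2 : (1 / 2 : ℝ) ≤ 0 := ge_of_tendsto' h1 fun m => by
      rw [norm_inv, Complex.norm_real, Real.norm_of_nonneg (sum_norm_sq_pos (hp m)).le, ← one_div]
      exact one_div_le_one_div_of_le (sum_norm_sq_pos (hp m)) (hsum m)
    norm_num at h2
  have hS : ((∑ i, ‖ζ i‖ ^ 2 : ℝ) : ℂ) ≠ 0 := by exact_mod_cast (sum_norm_sq_pos hζ).ne'
  have hζc : (starRingEnd ℂ) (ζ 0) ≠ 0 := by simpa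
  refine ⟨(ζ 0)⁻¹ • ζ, smul_ne_zero (inv_ne_zero hζ0) hζ, ?_, ?_⟩
  · rw [Projectivization.mk_eq_mk_iff']
    exact ⟨ζ 0, by rw [smul_smul, mul_inv_cancel₀ hζ0, one_smul]⟩
  · rw [tendsto_pi_nhds]
    intro i
    have := (hF i).div hF0 (by positivity)
    convert this using 2 with m
    · have : ((∑ i, ‖p m i‖ ^ 2 : ℝ) : ℂ) ≠ 0 := by exact_mod_cast (sum_norm_sq_pos (hp m)).ne'
      simp only [Pi.div_apply]
      field_simp
    · simp only [Pi.smul_apply, smul_eq_mul]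
      field_simp

end Chart

theorem accPts_subset {n : ℕ} {G : Subgroup (PGLn n)} (hPU : (G : Set (PGLn n)) ⊆ PUset n)
    (hdisc : DiscreteTopology G) {x y : Pn n} (hx : x ∈ Hball n) (hy : y ∈ Hball n) :
    accPts G x ⊆ accPts G y := by
  rintro z ⟨g, hg, hz⟩
  refine ⟨g, hg, ?_⟩
  obtain ⟨v, hv, rfl, hvn⟩ := hx
  obtain ⟨w, hw, rfl, hwn⟩ := hy
  choose A hA hAg using fun m => hPU (g m).2
  have hne (u : Vec n) (hu : (herm n u u).re < 0) (m : ℕ) : ((A m : Mat n) *ᵥ u) 0 ≠ 0 := by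
    intro h
    have h1 : (herm n ((A m : Mat n) *ᵥ u) ((A m : Mat n) *ᵥ u)).re < 0 := by rwa [hA m]
    rw [herm_self_re, h] at h1
    have : 0 ≤ ∑ j : Fin n, ‖((A m : Mat n) *ᵥ u) j.succ‖ ^ 2 := by positivity
    simp at h1
    linarith
  let P (u : Vec n) (m : ℕ) : Vec n := (((A m : Mat n) *ᵥ u) 0)⁻¹ • ((A m : Mat n) *ᵥ u)
  have hP0 (u : Vec n) (hu : (herm n u u).re < 0) (m : ℕ) : P u m 0 = 1 :=
    inv_mul_cancel₀ (hne u hu m)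
  have hP (u : Vec n) (hu : (herm n u u).re < 0) (m : ℕ) : P u m ≠ 0 := fun h => by
    simpa [h] using hP0 u hu m
  have hPn (u : Vec n) (hu : (herm n u u).re < 0) (m : ℕ) :
      (herm n (P u m) (P u m)).re ≤ 0 := by
    rw [herm_smul_self_re, hA m]
    exact mul_nonpos_of_nonneg_of_nonpos (by positivity) hu.le
  have hact (u : Vec n) (hu0 : u ≠ 0) (hu : (herm n u u).re < 0) (m : ℕ) :
      act (g m : PGLn n) (Projectivization.mk ℂ u hu0) =
        Projectivization.mk ℂ (P u m) (hP u hu m) := by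
    rw [← hAg m, act_coe_mk (A m) u hu0 fun h => hne u hu m (by rw [h]; rfl),
      Projectivization.mk_eq_mk_iff']
    exact ⟨((A m : Mat n) *ᵥ u) 0, by rw [smul_smul, mul_inv_cancel₀ (hne u hu m), one_smul]⟩
  simp only [hact v hv hvn] at hz
  simp only [hact w hw hwn]
  obtain ⟨ζ, hζ, rfl, hlim⟩ := tendsto_of_tendsto_mk (hP0 v hvn) (hPn v hvn) (hP v hvn) hz
  have hherm : Tendsto (fun m => 2 * ‖herm n (P v m) (P w m)‖) atTop (𝓝 0) := by
    have h1 := (tendsto_norm_mulVec_apply_zero hdisc hg hA hAg hvn).inv_tendsto_atTop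
    have h2 := (tendsto_norm_mulVec_apply_zero hdisc hg hA hAg hwn).inv_tendsto_atTop
    have h3 := ((h1.mul h2).mul_const ‖herm n v w‖).const_mul 2
    simp only [mul_zero, zero_mul] at h3
    refine h3.congr fun m => ?_
    rw [norm_herm_smul_smul, hA m, norm_inv, norm_inv]
    rfl
  have hlim' : Tendsto (P w) atTop (𝓝 ζ) := by
    rw [tendsto_pi_nhds] at hlim ⊢
    intro i
    have hsq : Tendsto (fun m => ‖P v m i - P w m i‖ ^ 2) atTop (𝓝 0) :=
      squeeze_zero (fun m => by positivity) (fun m => norm_sub_sq_le_of_herm_nonpos (hP0 v hvn m)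
        (hP0 w hwn m) (hPn v hvn m) (hPn w hwn m) i) hherm
    have hsub : Tendsto (fun m => P v m i - P w m i) atTop (𝓝 0) := by
      rw [tendsto_zero_iff_norm_tendsto_zero]
      simpa using hsq.sqrt
    simpa using (hlim i).sub hsub
  exact (continuous_projectivization_mk'.tendsto ⟨ζ, hζ⟩).comp
    (IsInducing.subtypeVal.tendsto_nhds_iff.2 hlim' :
      Tendsto (fun m => (⟨P w m, hP w hwn m⟩ : {u : Vec n // u ≠ 0})) atTop (𝓝 ⟨ζ, hζ⟩))

/-- For a discrete subgroup `G` of `PU(1,n)`, the set of accumulation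
points of the orbit `G ⬝ x` is the same for all `x ∈ 𝐇ⁿ_ℂ`; hence the Chen–Greenberg
limit set does not depend on the chosen orbit. -/
theorem limit_set_independent_of_orbit
    (n : ℕ) (hn : 1 ≤ n) (G : Subgroup (PGLn n))
    (hPU : (G : Set (PGLn n)) ⊆ PUset n) (hdisc : DiscreteTopology ↥G) :
    ∀ x ∈ Hball n, ∀ y ∈ Hball n, accPts G x = accPts G y := by
  exact fun x hx y hy => (accPts_subset hPU hdisc hx hy).antisymm (accPts_subset hPU hdisc hy hx)
end
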